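/- For every nondegenerate triangle K in ℝ², let Σ̊(K) := {τ ∈ Σ(K) : τ(x) n = 0 for every x ∈ ∂K, where n is the outward unit normal of ∂K at x}. Then div Σ̊(K) = {p ∈ ℙ₁(K;ℝ²) : ∫_K p · q dx = 0 for all q ∈ RM}, and moreover div restricted to Σ̊(K) is a linear bijection onto this space. -/

import Mathlib

open MeasureTheory Matrix

noncomputable section

/-- Points of the plane ℝ². -/
abbrev V2 := Fin 2 → ℝ

/-- 2×2 real matrices. -/
abbrev Mat2 := Matrix (Fin 2) (Fin 2) ℝ

/-- The Euclidean dot product on ℝ². -/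
def dot2 (x y : V2) : ℝ := x 0 * y 0 + x 1 * y 1

/-- The Euclidean norm on ℝ². -/
def norm2 (x : V2) : ℝ := Real.sqrt (dot2 x x)

/-- Rotation by -90 degrees, used to produce a unit normal from a unit tangent. -/
def rot (x : V2) : V2 := ![x 1, -(x 0)]

/-- The closed triangle with vertices `v 0, v 1, v 2`. -/
def tri (v : Fin 3 → V2) : Set V2 := convexHull ℝ (Set.range v)

/-- `f` is (the function of) a real polynomial in two variables of total degree at most `k`. -/
def PolyDeg (k : ℕ) (f : V2 → ℝ) : Prop :=
  ∃ p : MvPolynomial (Fin 2) ℝ, p.totalDegree ≤ k ∧ ∀ x : V2, f x = MvPolynomial.eval x p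

/-- matrix-valued polynomial fields of degree at most `k`, i.e. ℙ_k(·;𝕄). -/
def IsPolyMat (k : ℕ) (τ : V2 → Mat2) : Prop := ∀ i j, PolyDeg k fun x => τ x i j

/-- vector-valued polynomial fields of degree at most `k`, i.e. ℙ_k(·;ℝ²). -/
def IsPolyVec (k : ℕ) (f : V2 → V2) : Prop := ∀ i, PolyDeg k fun x => f x i

/-- `f` agrees on `[0,1]` with a univariate polynomial of degree at most `k`
(used for restrictions to an edge, in an affine parametrization of the edge). -/
def IsPoly1 (k : ℕ) (f : ℝ → ℝ) : Prop :=
  ∃ p : Polynomial ℝ, p.natDegree ≤ k ∧ ∀ s ∈ Set.Icc (0:ℝ) 1, f s = Polynomial.eval s p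

/-- Partial derivative in the `a`-th coordinate direction. -/
def pd (f : V2 → ℝ) (a : Fin 2) : V2 → ℝ := fun x => fderiv ℝ f x (Pi.single a 1)

/-- Directional derivative of `f` in direction `w`. -/
def dirD (f : V2 → ℝ) (w : V2) (x : V2) : ℝ := fderiv ℝ f x w

/-- Row-wise divergence of a matrix-valued field. -/
def divMat (τ : V2 → Mat2) : V2 → V2 := fun x i => ∑ j, pd (fun y => τ y i j) j x

/-- The edge `e i` of the triangle, opposite to the vertex `v i`. -/
def edgeSet (v : Fin 3 → V2) (i : Fin 3) : Set V2 := segment ℝ (v (i+1)) (v (i+2))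

/-- Affine parametrization of the edge `e i` over `[0,1]`. -/
def edgePt (v : Fin 3 → V2) (i : Fin 3) (s : ℝ) : V2 := v (i+1) + s • (v (i+2) - v (i+1))

/-- The length of the edge `e i`. -/
def elen (v : Fin 3 → V2) (i : Fin 3) : ℝ := norm2 (v (i+2) - v (i+1))

/-- The unit tangent vector of the edge `e i`. -/
def tang (v : Fin 3 → V2) (i : Fin 3) : V2 := (elen v i)⁻¹ • (v (i+2) - v (i+1))

/-- The unit normal vector of the edge `e i`. -/
def nrml (v : Fin 3 → V2) (i : Fin 3) : V2 := rot (tang v i)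

/-- The arclength integral over the edge `e i`. -/
def edgeInt (v : Fin 3 → V2) (i : Fin 3) (f : V2 → ℝ) : ℝ :=
  ∫ s in (0:ℝ)..1, f (edgePt v i s) * elen v i

/-- The symmetric part of a matrix. -/
def symm2 (A : Mat2) : Mat2 := (2:ℝ)⁻¹ • (A + Aᵀ)

/-- The shape function space Σ(K) = {τ ∈ ℙ₃(K;𝕊) : div τ ∈ ℙ₁(K;ℝ²),
tᵀτn|ₑ ∈ ℙ₂(e) for each edge e}. -/
def SigmaSet (v : Fin 3 → V2) : Set (V2 → Mat2) :=
  {τ | IsPolyMat 3 τ ∧ (∀ x, (τ x).IsSymm) ∧ IsPolyVec 1 (divMat τ) ∧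
    ∀ i : Fin 3, IsPoly1 2 fun s => dot2 (tang v i) ((τ (edgePt v i s)).mulVec (nrml v i))}

/-- The space RM of rigid motions in two dimensions: x ↦ a + b (x₂, −x₁)ᵀ. -/
def RM2 : Set (V2 → V2) := {u | ∃ a : V2, ∃ b : ℝ, ∀ x, u x = a + b • ![x 1, -(x 0)]}

/-- Σ̊(K): elements of Σ(K) whose normal trace vanishes on the whole boundary ∂K. -/
def SigmaRing (v : Fin 3 → V2) : Set (V2 → Mat2) :=
  {τ | τ ∈ SigmaSet v ∧ ∀ i : Fin 3, ∀ x ∈ edgeSet v i, (τ x).mulVec (nrml v i) = 0}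

/-- ℙ₁(K;ℝ²)/RM realized as the L²(K)-orthogonal complement of RM in ℙ₁(K;ℝ²). -/
def P1perpRM (v : Fin 3 → V2) : Set (V2 → V2) :=
  {p | IsPolyVec 1 p ∧ ∀ u ∈ RM2, ∫ x in tri v, dot2 (p x) (u x) = 0}

section Polynomials

lemma PolyDeg.mono {k l : ℕ} {f : V2 → ℝ} (hf : PolyDeg k f) (h : k ≤ l) : PolyDeg l f := by
  obtain ⟨p, hp, hf⟩ := hf
  exact ⟨p, hp.trans h, hf⟩

lemma polyDeg_const (k : ℕ) (a : ℝ) : PolyDeg k fun _ => a :=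
  ⟨MvPolynomial.C a, by simp, by simp⟩

lemma polyDeg_coord (i : Fin 2) : PolyDeg 1 fun x => x i :=
  ⟨MvPolynomial.X i, by simp, by simp⟩

lemma PolyDeg.add {k : ℕ} {f g : V2 → ℝ} (hf : PolyDeg k f) (hg : PolyDeg k g) :
    PolyDeg k fun x => f x + g x := by
  obtain ⟨p, hp, hf⟩ := hf
  obtain ⟨q, hq, hg⟩ := hg
  exact ⟨p + q, (MvPolynomial.totalDegree_add p q).trans (max_le hp hq), by simp [hf, hg]⟩

lemma PolyDeg.mul {k l : ℕ} {f g : V2 → ℝ} (hf : PolyDeg k f) (hg : PolyDeg l g) :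
    PolyDeg (k + l) fun x => f x * g x := by
  obtain ⟨p, hp, hf⟩ := hf
  obtain ⟨q, hq, hg⟩ := hg
  exact ⟨p * q, (MvPolynomial.totalDegree_mul p q).trans (add_le_add hp hq), by simp [hf, hg]⟩

lemma PolyDeg.const_mul {k : ℕ} {f : V2 → ℝ} (hf : PolyDeg k f) (a : ℝ) :
    PolyDeg k fun x => a * f x := by
  simpa using (polyDeg_const 0 a).mul hf

lemma PolyDeg.mul_const {k : ℕ} {f : V2 → ℝ} (hf : PolyDeg k f) (a : ℝ) :
    PolyDeg k fun x => f x * a := by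
  simpa using hf.mul (polyDeg_const 0 a)

lemma PolyDeg.sum {ι : Type*} {k : ℕ} (s : Finset ι) {f : ι → V2 → ℝ}
    (hf : ∀ i ∈ s, PolyDeg k (f i)) : PolyDeg k fun x => ∑ i ∈ s, f i x := by
  classical
  induction s using Finset.induction_on with
  | empty => simpa using polyDeg_const k 0
  | insert i s hi ih =>
    simp only [Finset.sum_insert hi]
    exact (hf i (by simp)).add (ih fun j hj => hf j (by simp [hj]))

lemma PolyDeg.pow {f : V2 → ℝ} (hf : PolyDeg 1 f) (n : ℕ) : PolyDeg n fun x => f x ^ n := by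
  induction n with
  | zero => simpa using polyDeg_const 0 1
  | succ n ih => simpa only [pow_succ] using ih.mul hf

lemma PolyDeg.exists_sum_monomials {k : ℕ} {f : V2 → ℝ} (hf : PolyDeg k f) :
    ∃ (s : Finset (Fin 2 →₀ ℕ)) (a : (Fin 2 →₀ ℕ) → ℝ), (∀ m ∈ s, m 0 + m 1 ≤ k) ∧
      ∀ x, f x = ∑ m ∈ s, a m * (x 0 ^ m 0 * x 1 ^ m 1) := by
  obtain ⟨p, hp, hf⟩ := hf
  refine ⟨p.support, p.coeff, fun m hm => ?_, fun x => ?_⟩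
  · have := MvPolynomial.le_totalDegree hm
    rw [Finsupp.sum_fintype _ _ (by simp), Fin.sum_univ_two] at this
    exact this.trans hp
  · rw [hf, MvPolynomial.eval_eq']
    simp [Fin.prod_univ_two]

lemma PolyDeg.comp {k : ℕ} {f : V2 → ℝ} (hf : PolyDeg k f) {g : V2 → V2}
    (hg : IsPolyVec 1 g) : PolyDeg k fun x => f (g x) := by
  obtain ⟨s, a, hs, hf⟩ := hf.exists_sum_monomials
  simp only [hf]
  exact PolyDeg.sum s fun m hm =>
    ((((hg 0).pow (m 0)).mul ((hg 1).pow (m 1))).mono (hs m hm)).const_mul (a m)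

/-- A polynomial function of degree at most `k` is given by its coefficients. -/
lemma PolyDeg.exists_coeff {k : ℕ} {f : V2 → ℝ} (hf : PolyDeg k f) :
    ∃ c : ℕ → ℕ → ℝ, ∀ x, f x = ∑ i ∈ Finset.range (k + 1), ∑ j ∈ Finset.range (k + 1 - i),
      c i j * (x 0 ^ i * x 1 ^ j) := by
  obtain ⟨s, a, hs, hf⟩ := hf.exists_sum_monomials
  refine ⟨fun i j => ∑ m ∈ s, if m 0 = i then if m 1 = j then a m else 0 else 0, fun x => ?_⟩
  simp only [hf, Finset.sum_mul]
  have hcomm : ∀ i, ∑ j ∈ Finset.range (k + 1 - i), ∑ m ∈ s,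
      (if m 0 = i then if m 1 = j then a m else 0 else 0) * (x 0 ^ i * x 1 ^ j) =
      ∑ m ∈ s, ∑ j ∈ Finset.range (k + 1 - i),
      (if m 0 = i then if m 1 = j then a m else 0 else 0) * (x 0 ^ i * x 1 ^ j) :=
    fun i => Finset.sum_comm
  simp only [hcomm]
  rw [Finset.sum_comm]
  refine Finset.sum_congr rfl fun m hm => ?_
  have h := hs m hm
  rw [Finset.sum_eq_single (m 0), Finset.sum_eq_single (m 1)]
  · simp
  · intro j _ hj
    simp [Ne.symm hj]
  · intro hj
    exact absurd (Finset.mem_range.2 (by omega)) hj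
  · intro i _ hi
    simp [Ne.symm hi]
  · intro hi
    exact absurd (Finset.mem_range.2 (by omega)) hi

lemma PolyDeg.differentiable {k : ℕ} {f : V2 → ℝ} (hf : PolyDeg k f) : Differentiable ℝ f := by
  obtain ⟨c, hc⟩ := hf.exists_coeff
  rw [funext hc]
  fun_prop

lemma PolyDeg.exists_affine {f : V2 → ℝ} (hf : PolyDeg 1 f) :
    ∃ c₀ c₁ c₂ : ℝ, ∀ x, f x = c₀ + c₁ * x 0 + c₂ * x 1 := by
  obtain ⟨c, hc⟩ := hf.exists_coeff
  refine ⟨c 0 0, c 1 0, c 0 1, fun x => ?_⟩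
  rw [hc]
  simp [Finset.sum_range_succ]
  ring

lemma PolyDeg.exists_cubic {f : V2 → ℝ} (hf : PolyDeg 3 f) :
    ∃ c : ℕ → ℕ → ℝ, ∀ x, f x = c 0 0 + c 1 0 * x 0 + c 0 1 * x 1 + c 2 0 * x 0 ^ 2 +
      c 1 1 * x 0 * x 1 + c 0 2 * x 1 ^ 2 + c 3 0 * x 0 ^ 3 + c 2 1 * x 0 ^ 2 * x 1 +
      c 1 2 * x 0 * x 1 ^ 2 + c 0 3 * x 1 ^ 3 := by
  obtain ⟨c, hc⟩ := hf.exists_coeff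
  refine ⟨c, fun x => ?_⟩
  rw [hc]
  simp [Finset.sum_range_succ]
  ring

lemma isPolyVec_mulVec {k : ℕ} {f : V2 → V2} (hf : IsPolyVec k f) (A : Mat2) :
    IsPolyVec k fun x => A *ᵥ f x := fun i =>
  PolyDeg.sum Finset.univ fun j _ => (hf j).const_mul (A i j)

lemma isPolyMat_mul_mul {k : ℕ} {τ : V2 → Mat2} (hτ : IsPolyMat k τ) (A B : Mat2) :
    IsPolyMat k fun x => A * τ x * B := fun i j => by
  simp only [Matrix.mul_apply]
  exact PolyDeg.sum _ fun l _ => (PolyDeg.sum _ fun m _ => (hτ m l).const_mul (A i m)).mul_const _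

end Polynomials

section Calculus

lemma pd_sum {ι : Type*} (s : Finset ι) {f : ι → V2 → ℝ} (hf : ∀ i ∈ s, Differentiable ℝ (f i))
    (a : Fin 2) (x : V2) : pd (fun y => ∑ i ∈ s, f i y) a x = ∑ i ∈ s, pd (f i) a x := by
  unfold pd
  rw [fderiv_fun_sum fun i hi => (hf i hi) x]
  simp

lemma pd_const_mul {f : V2 → ℝ} (hf : Differentiable ℝ f) (c : ℝ) (a : Fin 2) (x : V2) :
    pd (fun y => c * f y) a x = c * pd f a x := by
  unfold pd
  rw [fderiv_const_mul (hf x)]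
  simp

lemma pd_mul_const {f : V2 → ℝ} (hf : Differentiable ℝ f) (c : ℝ) (a : Fin 2) (x : V2) :
    pd (fun y => f y * c) a x = pd f a x * c := by
  simp only [mul_comm _ c, pd_const_mul hf]

lemma pd_comp_affine {f : V2 → ℝ} (hf : Differentiable ℝ f) (A : Mat2) (z : V2)
    (a : Fin 2) (x : V2) :
    pd (fun y => f (A *ᵥ (y - z))) a x = ∑ m, A m a * pd f m (A *ᵥ (x - z)) := by
  have hg : HasFDerivAt (fun y : V2 => A *ᵥ (y - z)) (Matrix.toLin' A).toContinuousLinearMap x := by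
    have := (Matrix.toLin' A).toContinuousLinearMap.hasFDerivAt.comp x
      ((hasFDerivAt_id x).sub_const z)
    simpa [Function.comp_def] using this
  have h := (hf (A *ᵥ (x - z))).hasFDerivAt.comp x hg
  unfold pd
  rw [show (fun y => f (A *ᵥ (y - z))) = f ∘ fun y => A *ᵥ (y - z) from rfl, h.fderiv]
  have hs : A *ᵥ Pi.single a 1 = ∑ m, A m a • (Pi.single m 1 : V2) := by
    ext i
    fin_cases i <;> simp
  simp only [ContinuousLinearMap.comp_apply, LinearMap.coe_toContinuousLinearMap',
    Matrix.toLin'_apply, hs, map_sum, map_smul, smul_eq_mul]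

/-- The divergence commutes with the Piola transform of matrix fields. -/
lemma divMat_piola {B : Mat2} (hB : IsUnit B.det) {σ : V2 → Mat2}
    (hσ : ∀ i j, Differentiable ℝ fun y => σ y i j) (z x : V2) :
    divMat (fun y => B * σ (B⁻¹ *ᵥ (y - z)) * Bᵀ) x = B *ᵥ divMat σ (B⁻¹ *ᵥ (x - z)) := by
  have hd : ∀ k l, Differentiable ℝ fun y : V2 => σ (B⁻¹ *ᵥ (y - z)) k l := fun k l =>
    (hσ k l).comp (g := fun y => σ y k l) (f := fun y : V2 => B⁻¹ *ᵥ (y - z)) <| by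
      have : Differentiable ℝ fun y : V2 => (Matrix.toLin' B⁻¹).toContinuousLinearMap (y - z) := by
        fun_prop
      simpa using this
  ext i
  have h1 : ∀ j, pd (fun y => (B * σ (B⁻¹ *ᵥ (y - z)) * Bᵀ) i j) j x =
      ∑ l, ∑ k, ∑ m, B i k * pd (fun y => σ y k l) m (B⁻¹ *ᵥ (x - z)) * (B⁻¹ m j * B j l) := by
    intro j
    simp only [Matrix.mul_apply, Matrix.transpose_apply]
    have hs : ∀ l, Differentiable ℝ fun y : V2 => ∑ k, B i k * σ (B⁻¹ *ᵥ (y - z)) k l := fun l =>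
      Differentiable.fun_sum fun k _ => (hd k l).const_mul (B i k)
    rw [pd_sum _ fun l _ => (hs l).mul_const (B j l)]
    refine Finset.sum_congr rfl fun l _ => ?_
    rw [pd_mul_const (hs l), pd_sum _ fun k _ => (hd k l).const_mul (B i k), Finset.sum_mul]
    refine Finset.sum_congr rfl fun k _ => ?_
    rw [pd_const_mul (hd k l), pd_comp_affine (hσ k l), Finset.mul_sum, Finset.sum_mul]
    exact Finset.sum_congr rfl fun m _ => by ring
  have h2 : ∀ m l, ∑ j, B⁻¹ m j * B j l = (1 : Mat2) m l := fun m l => by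
    rw [← Matrix.nonsing_inv_mul B hB, Matrix.mul_apply]
  have h00 := h2 0 0
  have h01 := h2 0 1
  have h10 := h2 1 0
  have h11 := h2 1 1
  simp only [Fin.sum_univ_two, Matrix.one_apply] at h00 h01 h10 h11
  simp only [divMat, h1, Matrix.mulVec, dotProduct, Fin.sum_univ_two]
  norm_num at h00 h01 h10 h11
  generalize B⁻¹ *ᵥ (x - z) = w
  generalize pd (fun y => σ y 0 0) 0 w = a
  generalize pd (fun y => σ y 0 0) 1 w = b
  generalize pd (fun y => σ y 0 1) 0 w = c
  generalize pd (fun y => σ y 0 1) 1 w = d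
  generalize pd (fun y => σ y 1 0) 0 w = e
  generalize pd (fun y => σ y 1 0) 1 w = f
  generalize pd (fun y => σ y 1 1) 0 w = g
  generalize pd (fun y => σ y 1 1) 1 w = h
  linear_combination (B i 0 * a + B i 1 * e) * h00 + (B i 0 * b + B i 1 * f) * h10 +
    (B i 0 * c + B i 1 * g) * h01 + (B i 0 * d + B i 1 * h) * h11

lemma pd_cubic {f : V2 → ℝ} {c : ℕ → ℕ → ℝ}
    (hf : ∀ x, f x = c 0 0 + c 1 0 * x 0 + c 0 1 * x 1 + c 2 0 * x 0 ^ 2 +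
      c 1 1 * x 0 * x 1 + c 0 2 * x 1 ^ 2 + c 3 0 * x 0 ^ 3 + c 2 1 * x 0 ^ 2 * x 1 +
      c 1 2 * x 0 * x 1 ^ 2 + c 0 3 * x 1 ^ 3) (x : V2) :
    pd f 0 x = c 1 0 + 2 * c 2 0 * x 0 + c 1 1 * x 1 + 3 * c 3 0 * x 0 ^ 2 +
      2 * c 2 1 * x 0 * x 1 + c 1 2 * x 1 ^ 2 ∧
    pd f 1 x = c 0 1 + c 1 1 * x 0 + 2 * c 0 2 * x 1 + c 2 1 * x 0 ^ 2 +
      2 * c 1 2 * x 0 * x 1 + 3 * c 0 3 * x 1 ^ 2 := by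
  have h0 : HasFDerivAt (fun x : V2 => x 0) (ContinuousLinearMap.proj (R := ℝ) 0) x :=
    hasFDerivAt_apply 0 x
  have h1 : HasFDerivAt (fun x : V2 => x 1) (ContinuousLinearMap.proj (R := ℝ) 1) x :=
    hasFDerivAt_apply 1 x
  have h := ((((((((h0.const_mul (c 1 0)).const_add (c 0 0)).add (h1.const_mul (c 0 1))).add
    ((h0.pow 2).const_mul (c 2 0))).add ((h0.const_mul (c 1 1)).mul h1)).add
    ((h1.pow 2).const_mul (c 0 2))).add ((h0.pow 3).const_mul (c 3 0))).add
    (((h0.pow 2).const_mul (c 2 1)).mul h1)).add ((h0.const_mul (c 1 2)).mul (h1.pow 2)) |>.add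
    ((h1.pow 3).const_mul (c 0 3))
  have hf' := h.congr_of_eventuallyEq (.of_forall hf)
  unfold pd
  rw [hf'.fderiv]
  constructor
  · simp
    ring
  · simp
    ring

end Calculus

section ReferenceTriangle

/-- The closed reference triangle with vertices `(0, 0)`, `(1, 0)` and `(0, 1)`. -/
def refTri : Set V2 := {y | 0 ≤ y 0 ∧ 0 ≤ y 1 ∧ y 0 + y 1 ≤ 1}

/-- The point with parameter `r` on the edge of the reference triangle opposite the vertex `i`. -/
def refEdgePt (i : Fin 3) (r : ℝ) : V2 := ![![1 - r, r], ![0, 1 - r], ![r, 0]] i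

/-- A normal vector of the edge of the reference triangle opposite the vertex `i`. -/
def refNormal (i : Fin 3) : V2 := ![![1, 1], ![-1, 0], ![0, -1]] i

/-- The quadratic symmetric matrix field on the reference triangle which is a combination, with
coefficients `a`, `b` and `-q`, of the edge bubbles times the tensor squares of the tangents. -/
def bubble (a b q : ℝ) (y : V2) : Mat2 :=
  !![a * y 0 * (1 - y 0 - y 1) - q * y 0 * y 1, q * y 0 * y 1;
    q * y 0 * y 1, b * y 1 * (1 - y 0 - y 1) - q * y 0 * y 1]

lemma isSymm_bubble (a b q : ℝ) (y : V2) : (bubble a b q y).IsSymm := by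
  ext i j
  fin_cases i <;> fin_cases j <;> simp [bubble]

lemma isPolyMat_bubble (a b q : ℝ) : IsPolyMat 3 (bubble a b q) := by
  have hm (c : ℝ) (i j : Fin 2) : PolyDeg 3 fun y => c * (y i * y j) :=
    (((polyDeg_coord i).mul (polyDeg_coord j)).const_mul c).mono (by norm_num)
  have hl (c : ℝ) (i : Fin 2) : PolyDeg 3 fun y => c * y i :=
    ((polyDeg_coord i).const_mul c).mono (by norm_num)
  intro i j
  fin_cases i <;> fin_cases j
  · convert! (((hl a 0).add (hm (-a) 0 0)).add (hm (-a) 0 1)).add (hm (-q) 0 1) using 2 with y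
    simp [bubble]
    ring
  · convert! hm q 0 1 using 2 with y
    simp [bubble]
    ring
  · convert! hm q 0 1 using 2 with y
    simp [bubble]
    ring
  · convert! (((hl b 1).add (hm (-b) 0 1)).add (hm (-b) 1 1)).add (hm (-q) 0 1) using 2 with y
    simp [bubble]
    ring

lemma bubble_mulVec_refNormal (a b q : ℝ) (i : Fin 3) (r : ℝ) :
    bubble a b q (refEdgePt i r) *ᵥ refNormal i = 0 := by
  ext j
  fin_cases i <;> fin_cases j <;> simp [bubble, refEdgePt, refNormal]

lemma divMat_cubic {σ : V2 → Mat2} {c : Fin 2 → Fin 2 → ℕ → ℕ → ℝ}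
    (hc : ∀ i j x, σ x i j = c i j 0 0 + c i j 1 0 * x 0 + c i j 0 1 * x 1 +
      c i j 2 0 * x 0 ^ 2 + c i j 1 1 * x 0 * x 1 + c i j 0 2 * x 1 ^ 2 + c i j 3 0 * x 0 ^ 3 +
      c i j 2 1 * x 0 ^ 2 * x 1 + c i j 1 2 * x 0 * x 1 ^ 2 + c i j 0 3 * x 1 ^ 3)
    (x : V2) (i : Fin 2) :
    divMat σ x i = c i 0 1 0 + 2 * c i 0 2 0 * x 0 + c i 0 1 1 * x 1 + 3 * c i 0 3 0 * x 0 ^ 2 +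
      2 * c i 0 2 1 * x 0 * x 1 + c i 0 1 2 * x 1 ^ 2 + (c i 1 0 1 + c i 1 1 1 * x 0 +
      2 * c i 1 0 2 * x 1 + c i 1 2 1 * x 0 ^ 2 + 2 * c i 1 1 2 * x 0 * x 1 +
      3 * c i 1 0 3 * x 1 ^ 2) := by
  rw [divMat, Fin.sum_univ_two, (pd_cubic (hc i 0) x).1, (pd_cubic (hc i 1) x).2]

lemma divMat_bubble (a b q : ℝ) (y : V2) : divMat (bubble a b q) y =
    ![a + (q - 2 * a) * y 0 - (a + q) * y 1, b - (b + q) * y 0 + (q - 2 * b) * y 1] := by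
  let c : Fin 2 → Fin 2 → ℕ → ℕ → ℝ := ![![
    fun i j => if (i, j) = (1, 0) then a else if (i, j) = (2, 0) then -a else
      if (i, j) = (1, 1) then -a - q else 0,
    fun i j => if (i, j) = (1, 1) then q else 0],
    ![fun i j => if (i, j) = (1, 1) then q else 0,
    fun i j => if (i, j) = (0, 1) then b else if (i, j) = (0, 2) then -b else
      if (i, j) = (1, 1) then -b - q else 0]]
  ext i
  rw [divMat_cubic (c := c)]
  · fin_cases i
    · simp [c]
      ring
    · simp [c]
      ring
  · intro i j x
    fin_cases i <;> fin_cases j <;> simp [c, bubble] <;> ring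

lemma isPolyVec_divMat_bubble (a b q : ℝ) : IsPolyVec 1 (divMat (bubble a b q)) := by
  have hl (c : ℝ) (i : Fin 2) : PolyDeg 1 fun y => c * y i := (polyDeg_coord i).const_mul c
  intro i
  fin_cases i
  · convert! ((polyDeg_const 1 a).add (hl (q - 2 * a) 0)).add (hl (-(a + q)) 1) using 2 with y
    simp [divMat_bubble]
    ring
  · convert! ((polyDeg_const 1 b).add (hl (-(b + q)) 0)).add (hl (q - 2 * b) 1) using 2 with y
    simp [divMat_bubble]
    ring

lemma bubble_eq_of_divMat_eq {a b q a' b' q' : ℝ}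
    (h : divMat (bubble a b q) = divMat (bubble a' b' q')) : bubble a b q = bubble a' b' q' := by
  have h₀ := congrFun (congrFun h 0)
  have h₁ := congrFun (congrFun h ![1, 0]) 0
  simp [divMat_bubble, Fin.forall_fin_two] at h₀ h₁
  obtain ⟨rfl, rfl⟩ := h₀
  obtain rfl : q = q' := by linarith
  rfl

lemma cubic_coeff_eq_zero {c₀ c₁ c₂ c₃ : ℝ}
    (h : ∀ r ∈ Set.Icc (0 : ℝ) 1, c₀ + c₁ * r + c₂ * r ^ 2 + c₃ * r ^ 3 = 0) :
    c₀ = 0 ∧ c₁ = 0 ∧ c₂ = 0 ∧ c₃ = 0 := by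
  have h₀ := h 0 (by norm_num)
  have h₁ := h (1 / 3) (by norm_num)
  have h₂ := h (2 / 3) (by norm_num)
  have h₃ := h 1 (by norm_num)
  refine ⟨?_, ?_, ?_, ?_⟩ <;> linarith

lemma quadratic_coeff_eq_zero {c₀ c₁ c₂ c₃ c₄ c₅ : ℝ}
    (h : ∀ s t : ℝ, c₀ + c₁ * s + c₂ * t + c₃ * s ^ 2 + c₄ * s * t + c₅ * t ^ 2 = 0) :
    c₀ = 0 ∧ c₁ = 0 ∧ c₂ = 0 ∧ c₃ = 0 ∧ c₄ = 0 ∧ c₅ = 0 := by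
  have h₀ := h 0 0
  have h₁ := h 1 0
  have h₂ := h (-1) 0
  have h₃ := h 0 1
  have h₄ := h 0 (-1)
  have h₅ := h 1 1
  refine ⟨?_, ?_, ?_, ?_, ?_, ?_⟩ <;> linarith

/-- A symmetric cubic field on the reference triangle with vanishing normal trace and affine
divergence is one of the quadratic fields `bubble a b q`. -/
lemma exists_eq_bubble {σ : V2 → Mat2} (hσ : IsPolyMat 3 σ) (hs : ∀ y, (σ y).IsSymm)
    (hd : IsPolyVec 1 (divMat σ))
    (hn : ∀ i, ∀ r ∈ Set.Icc (0 : ℝ) 1, σ (refEdgePt i r) *ᵥ refNormal i = 0) :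
    ∃ a b q, σ = bubble a b q := by
  choose e he using fun i j => (hσ i j).exists_cubic
  obtain ⟨c, hc, hc10⟩ : ∃ c : Fin 2 → Fin 2 → ℕ → ℕ → ℝ, (∀ i j x, σ x i j =
      c i j 0 0 + c i j 1 0 * x 0 + c i j 0 1 * x 1 +
      c i j 2 0 * x 0 ^ 2 + c i j 1 1 * x 0 * x 1 + c i j 0 2 * x 1 ^ 2 + c i j 3 0 * x 0 ^ 3 +
      c i j 2 1 * x 0 ^ 2 * x 1 + c i j 1 2 * x 0 * x 1 ^ 2 + c i j 0 3 * x 1 ^ 3) ∧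
      c 1 0 = c 0 1 := by
    refine ⟨![![e 0 0, e 0 1], ![e 0 1, e 1 1]], fun i j x => ?_, rfl⟩
    fin_cases i <;> fin_cases j
    · exact he 0 0 x
    · exact he 0 1 x
    · exact ((hs x).apply 0 1).trans (he 0 1 x)
    · exact he 1 1 x
  have hn' : ∀ i j, ∀ r ∈ Set.Icc (0 : ℝ) 1,
      σ (refEdgePt i r) j 0 * refNormal i 0 + σ (refEdgePt i r) j 1 * refNormal i 1 = 0 := by
    intro i j r hr
    have := congrFun (hn i r hr) j
    simpa [Matrix.mulVec, dotProduct, Fin.sum_univ_two] using this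
  choose d₀ d₁ d₂ hd using fun i => (hd i).exists_affine
  have hdiv := fun x i => (divMat_cubic hc x i).symm.trans (hd i x)
  have hdiv' : ∀ i, _ := fun i => quadratic_coeff_eq_zero
    (c₀ := c i 0 1 0 + c i 1 0 1 - d₀ i) (c₁ := 2 * c i 0 2 0 + c i 1 1 1 - d₁ i)
    (c₂ := c i 0 1 1 + 2 * c i 1 0 2 - d₂ i) (c₃ := 3 * c i 0 3 0 + c i 1 2 1)
    (c₄ := 2 * c i 0 2 1 + 2 * c i 1 1 2) (c₅ := c i 0 1 2 + 3 * c i 1 0 3)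
    fun s t => by
      have := hdiv ![s, t] i
      simp only [cons_val_zero, cons_val_one] at this
      linear_combination this
  have hleft : ∀ j, _ := fun j => cubic_coeff_eq_zero
    (c₀ := c j 0 0 0) (c₁ := c j 0 0 1) (c₂ := c j 0 0 2) (c₃ := c j 0 0 3) fun r hr => by
      have := hn' 1 j (1 - r) ⟨by linarith [hr.2], by linarith [hr.1]⟩
      simp only [hc] at this
      simp [refEdgePt, refNormal] at this
      linear_combination -this
  have hbot : ∀ j, _ := fun j => cubic_coeff_eq_zero
    (c₀ := c j 1 0 0) (c₁ := c j 1 1 0) (c₂ := c j 1 2 0) (c₃ := c j 1 3 0) fun r hr => by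
      have := hn' 2 j r hr
      simp only [hc] at this
      simp [refEdgePt, refNormal] at this
      linear_combination -this
  have hdiag : ∀ j, _ := fun j => cubic_coeff_eq_zero
    (c₀ := ∑ l, (c j l 0 0 + c j l 1 0 + c j l 2 0 + c j l 3 0))
    (c₁ := ∑ l, (-c j l 1 0 + c j l 0 1 - 2 * c j l 2 0 + c j l 1 1 - 3 * c j l 3 0 + c j l 2 1))
    (c₂ := ∑ l, (c j l 2 0 - c j l 1 1 + c j l 0 2 + 3 * c j l 3 0 - 2 * c j l 2 1 + c j l 1 2))
    (c₃ := ∑ l, (-c j l 3 0 + c j l 2 1 - c j l 1 2 + c j l 0 3)) fun r hr => by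
      have := hn' 0 j r hr
      simp only [hc] at this
      simp [refEdgePt, refNormal] at this
      simp only [Fin.sum_univ_two]
      linear_combination this
  simp only [Fin.forall_fin_two, Fin.sum_univ_two, hc10] at hdiv' hleft hbot hdiag
  obtain ⟨⟨-, -, -, f₁, f₂, f₃⟩, -, -, -, f₄, f₅, f₆⟩ := hdiv'
  obtain ⟨⟨l₁, l₂, l₃, l₄⟩, l₅, l₆, l₇, l₈⟩ := hleft
  obtain ⟨⟨b₁, b₂, b₃, b₄⟩, b₅, b₆, b₇, b₈⟩ := hbot
  obtain ⟨⟨g₁, g₂, g₃, g₄⟩, g₅, g₆, g₇, g₈⟩ := hdiag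
  have e₁ : c 0 1 2 1 = 0 := by linarith
  have e₂ : c 0 1 1 2 = 0 := by linarith
  have e₃ : c 0 0 3 0 = 0 := by linarith
  have e₄ : c 0 0 2 1 = 0 := by linarith
  have e₅ : c 0 0 1 2 = 0 := by linarith
  have e₆ : c 1 1 0 3 = 0 := by linarith
  have e₇ : c 1 1 1 2 = 0 := by linarith
  have e₈ : c 1 1 2 1 = 0 := by linarith
  have e₉ : c 0 0 2 0 = -c 0 0 1 0 := by linarith
  have e₁₀ : c 0 0 1 1 = -c 0 0 1 0 - c 0 1 1 1 := by linarith
  have e₁₁ : c 1 1 0 2 = -c 1 1 0 1 := by linarith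
  have e₁₂ : c 1 1 1 1 = -c 1 1 0 1 - c 0 1 1 1 := by linarith
  refine ⟨c 0 0 1 0, c 1 1 0 1, c 0 1 1 1, ?_⟩
  ext y i j
  rw [hc]
  fin_cases i <;> fin_cases j <;> simp [bubble, *] <;> ring

end ReferenceTriangle

section Integration

lemma isCompact_refTri : IsCompact refTri := by
  refine (isCompact_Icc (a := (0 : V2)) (b := 1)).of_isClosed_subset ?_ ?_
  · exact (isClosed_le continuous_const (continuous_apply 0)).inter
      ((isClosed_le continuous_const (continuous_apply 1)).inter
      (isClosed_le ((continuous_apply 0).add (continuous_apply 1)) continuous_const))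
  · rintro y ⟨h₀, h₁, h⟩
    rw [Set.mem_Icc, Pi.le_def, Pi.le_def, Fin.forall_fin_two, Fin.forall_fin_two]
    exact ⟨⟨h₀, h₁⟩, by simp; linarith, by simp; linarith⟩

lemma setIntegral_refTri {f : V2 → ℝ} (hf : Continuous f) :
    ∫ y in refTri, f y = ∫ s in (0 : ℝ)..1, ∫ t in (0 : ℝ)..(1 - s), f ![s, t] := by
  have hT := isCompact_refTri.measurableSet
  have hmp := (volume_preserving_finTwoArrow ℝ).symm
  have hint : Integrable (refTri.indicator f) :=
    (hf.continuousOn.integrableOn_compact isCompact_refTri).integrable_indicator hT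
  rw [← integral_indicator hT, ← hmp.integral_comp (MeasurableEquiv.measurableEmbedding _),
    Measure.volume_eq_prod, integral_prod]
  · rw [intervalIntegral.integral_of_le zero_le_one, ← integral_Icc_eq_integral_Ioc,
      ← integral_indicator measurableSet_Icc]
    congr 1 with s
    have hsec : (fun t => refTri.indicator f (MeasurableEquiv.finTwoArrow.symm (s, t))) =
        fun t => (Set.Icc 0 1).indicator
          (fun s => (Set.Icc 0 (1 - s)).indicator (fun t => f ![s, t]) t) s := by
      ext t
      change refTri.indicator f ![s, t] = _
      simp only [Set.indicator_apply, refTri, Set.mem_ofPred_eq, Set.mem_Icc, cons_val_zero,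
        cons_val_one]
      split_ifs <;> grind
    rw [hsec]
    by_cases hs : s ∈ Set.Icc (0 : ℝ) 1
    · simp only [Set.indicator_of_mem hs]
      rw [integral_indicator measurableSet_Icc, integral_Icc_eq_integral_Ioc,
        intervalIntegral.integral_of_le (by linarith [hs.2])]
    · simp [Set.indicator_of_notMem hs]
  · rw [← Measure.volume_eq_prod]
    exact hmp.integrable_comp_of_integrable hint

lemma setIntegral_refTri_quadratic {f : V2 → ℝ} {c₀ c₁ c₂ c₃ c₄ c₅ : ℝ} (hf : ∀ y, f y =
      c₀ + c₁ * y 0 + c₂ * y 1 + c₃ * y 0 ^ 2 + c₄ * y 0 * y 1 + c₅ * y 1 ^ 2) :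
    ∫ y in refTri, f y = c₀ / 2 + c₁ / 6 + c₂ / 6 + c₃ / 12 + c₄ / 24 + c₅ / 12 := by
  rw [setIntegral_refTri (by rw [funext hf]; fun_prop)]
  simp only [hf, cons_val_zero, cons_val_one]
  have inner : ∀ s : ℝ, ∫ t in (0 : ℝ)..(1 - s),
      (c₀ + c₁ * s + c₂ * t + c₃ * s ^ 2 + c₄ * s * t + c₅ * t ^ 2) =
      (c₀ + c₁ * s + c₃ * s ^ 2) * (1 - s) + (c₂ + c₄ * s) * (1 - s) ^ 2 / 2 +
        c₅ * (1 - s) ^ 3 / 3 := by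
    intro s
    rw [intervalIntegral.integral_eq_sub_of_hasDerivAt (f := fun t =>
      (c₀ + c₁ * s + c₃ * s ^ 2) * t + (c₂ + c₄ * s) * t ^ 2 / 2 + c₅ * t ^ 3 / 3)]
    · ring
    · intro t _
      have h := hasDerivAt_id' t
      convert! ((h.const_mul (c₀ + c₁ * s + c₃ * s ^ 2)).add
        (((h.pow 2).const_mul (c₂ + c₄ * s)).div_const 2)).add
        (((h.pow 3).const_mul c₅).div_const 3) using 1
      norm_num
      ring
    · exact Continuous.intervalIntegrable (by fun_prop) _ _
  simp only [inner]
  rw [intervalIntegral.integral_eq_sub_of_hasDerivAt (f := fun s =>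
    c₀ * s + (c₁ - c₀) * s ^ 2 / 2 + (c₃ - c₁) * s ^ 3 / 3 - c₃ * s ^ 4 / 4 +
    c₂ / 2 * (s - s ^ 2 + s ^ 3 / 3) + c₄ / 2 * (s ^ 2 / 2 - 2 * s ^ 3 / 3 + s ^ 4 / 4) +
    c₅ / 3 * (s - 3 * s ^ 2 / 2 + s ^ 3 - s ^ 4 / 4))]
  · ring
  · intro s _
    have h := hasDerivAt_id' s
    convert! ((((((h.const_mul c₀).add (((h.pow 2).const_mul (c₁ - c₀)).div_const 2)).add
      (((h.pow 3).const_mul (c₃ - c₁)).div_const 3)).sub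
      (((h.pow 4).const_mul c₃).div_const 4)).add
      (((h.sub (h.pow 2)).add ((h.pow 3).div_const 3)).const_mul (c₂ / 2))).add
      (((((h.pow 2).div_const 2).sub (((h.pow 3).const_mul 2).div_const 3)).add
      ((h.pow 4).div_const 4)).const_mul (c₄ / 2))).add
      ((((h.sub (((h.pow 2).const_mul 3).div_const 2)).add (h.pow 3)).sub
      ((h.pow 4).div_const 4)).const_mul (c₅ / 3)) using 1
    norm_num
    ring
  · exact Continuous.intervalIntegrable (by fun_prop) _ _

/-- An affine vector field on the reference triangle is orthogonal to the rigid motions if and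
only if it is the divergence of some `bubble a b q`. -/
lemma forall_setIntegral_refTri_eq_zero_iff {d : V2 → V2} (hd : IsPolyVec 1 d) :
    (∀ u ∈ RM2, ∫ y in refTri, dot2 (d y) (u y) = 0) ↔
      ∃ a b q, divMat (bubble a b q) = d := by
  choose k l m hd using fun i => (hd i).exists_affine
  have hint : ∀ (a : V2) (b : ℝ) (u : V2 → V2), (∀ y, u y = a + b • ![y 1, -(y 0)]) →
      ∫ y in refTri, dot2 (d y) (u y) =
        a 0 * (k 0 / 2 + l 0 / 6 + m 0 / 6) + a 1 * (k 1 / 2 + l 1 / 6 + m 1 / 6) +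
        b * (k 0 / 6 + l 0 / 24 + m 0 / 12 - k 1 / 6 - l 1 / 12 - m 1 / 24) := by
    intro a b u hu
    rw [setIntegral_refTri_quadratic
      (c₀ := k 0 * a 0 + k 1 * a 1) (c₁ := l 0 * a 0 + l 1 * a 1 - b * k 1)
      (c₂ := m 0 * a 0 + m 1 * a 1 + b * k 0) (c₃ := -b * l 1)
      (c₄ := b * (l 0 - m 1)) (c₅ := b * m 0)]
    · ring
    · intro y
      simp [dot2, hd, hu]
      ring
  constructor
  · intro h
    have h₀ := (hint ![1, 0] 0 _ fun _ => rfl).symm.trans (h _ ⟨_, _, fun _ => rfl⟩)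
    have h₁ := (hint ![0, 1] 0 _ fun _ => rfl).symm.trans (h _ ⟨_, _, fun _ => rfl⟩)
    have h₂ := (hint 0 1 _ fun _ => rfl).symm.trans (h _ ⟨_, _, fun _ => rfl⟩)
    norm_num at h₀ h₁ h₂
    refine ⟨k 0, k 1, l 0 + 2 * k 0, ?_⟩
    ext y i
    rw [divMat_bubble, hd]
    have e₀ : m 0 = -3 * k 0 - l 0 := by linarith
    have e₁ : l 1 = -k 1 - (l 0 + 2 * k 0) := by linarith
    have e₂ : m 1 = l 0 + 2 * k 0 - 2 * k 1 := by linarith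
    fin_cases i
    · simp [e₀]
      ring
    · simp [e₁, e₂]
      ring
  · rintro ⟨a, b, q, rfl⟩ u ⟨r, w, hu⟩
    rw [hint r w u hu]
    have hc : ∀ s t i, _ := fun s t i => (congrFun (divMat_bubble a b q ![s, t]) i).symm.trans
      (hd i ![s, t])
    have h₀ := hc 0 0
    have h₁ := hc 1 0
    have h₂ := hc 0 1
    simp [Fin.forall_fin_two] at h₀ h₁ h₂
    have e₁ : k 0 / 2 + l 0 / 6 + m 0 / 6 = 0 := by linarith
    have e₂ : k 1 / 2 + l 1 / 6 + m 1 / 6 = 0 := by linarith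
    have e₃ : k 0 / 6 + l 0 / 24 + m 0 / 12 - k 1 / 6 - l 1 / 12 - m 1 / 24 = 0 := by linarith
    rw [e₁, e₂, e₃]
    ring

end Integration

section Triangle

/-- The matrix whose columns are the edge vectors of the triangle at the vertex `v 0`. -/
def edgeMat (v : Fin 3 → V2) : Mat2 :=
  !![v 1 0 - v 0 0, v 2 0 - v 0 0; v 1 1 - v 0 1, v 2 1 - v 0 1]

/-- The affine map sending the reference triangle to the triangle with vertices `v`. -/
def affMap (v : Fin 3 → V2) (y : V2) : V2 := v 0 + edgeMat v *ᵥ y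

/-- The affine map sending the triangle with vertices `v` to the reference triangle. -/
def affInv (v : Fin 3 → V2) (x : V2) : V2 := (edgeMat v)⁻¹ *ᵥ (x - v 0)

/-- The Piola transform of a matrix field on the reference triangle. -/
def piola (v : Fin 3 → V2) (σ : V2 → Mat2) (x : V2) : Mat2 :=
  edgeMat v * σ (affInv v x) * (edgeMat v)ᵀ

variable {v : Fin 3 → V2}

lemma isUnit_det_edgeMat (hv : AffineIndependent ℝ v) : IsUnit (edgeMat v).det := by
  rw [isUnit_iff_ne_zero]
  intro h
  obtain ⟨w, hw, hw0⟩ := Matrix.exists_mulVec_eq_zero_iff.2 h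
  rw [affineIndependent_iff_of_fintype] at hv
  have h0 := congrFun hw0 0
  have h1 := congrFun hw0 1
  simp [edgeMat, Matrix.mulVec, dotProduct] at h0 h1
  have := hv ![-w 0 - w 1, w 0, w 1] (by simp [Fin.sum_univ_three]; ring) <| by
    rw [Finset.weightedVSub_eq_weightedVSubOfPoint_of_sum_eq_zero _ _ _
      (by simp [Fin.sum_univ_three]; ring) (0 : V2), Finset.weightedVSubOfPoint_apply]
    ext i
    fin_cases i
    · simp [Fin.sum_univ_three]
      linarith
    · simp [Fin.sum_univ_three]
      linarith
  refine hw (funext fun i => ?_)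
  fin_cases i
  · exact this 1
  · exact this 2

lemma affMap_affInv (hv : AffineIndependent ℝ v) (x : V2) : affMap v (affInv v x) = x := by
  rw [affMap, affInv, Matrix.mulVec_mulVec, Matrix.mul_nonsing_inv _ (isUnit_det_edgeMat hv),
    Matrix.one_mulVec, add_sub_cancel]

lemma affInv_affMap (hv : AffineIndependent ℝ v) (y : V2) : affInv v (affMap v y) = y := by
  rw [affMap, affInv, add_sub_cancel_left, Matrix.mulVec_mulVec,
    Matrix.nonsing_inv_mul _ (isUnit_det_edgeMat hv), Matrix.one_mulVec]

lemma isPolyVec_affMap : IsPolyVec 1 (affMap v) := fun i =>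
  (polyDeg_const 1 (v 0 i)).add (isPolyVec_mulVec (f := fun y => y) polyDeg_coord (edgeMat v) i)

lemma isPolyVec_affInv : IsPolyVec 1 (affInv v) :=
  isPolyVec_mulVec (f := fun x => x - v 0)
    (fun i => by simpa [sub_eq_add_neg] using (polyDeg_coord i).add (polyDeg_const 1 (-v 0 i))) _

lemma affMap_refEdgePt (i : Fin 3) (r : ℝ) : affMap v (refEdgePt i r) = edgePt v i r := by
  ext j
  fin_cases i <;> fin_cases j <;>
    simp [affMap, edgeMat, refEdgePt, edgePt] <;> ring

lemma edgeSet_eq_image (i : Fin 3) : edgeSet v i = edgePt v i '' Set.Icc 0 1 :=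
  segment_eq_image' ℝ _ _

lemma elen_ne_zero (hv : AffineIndependent ℝ v) (i : Fin 3) : elen v i ≠ 0 := by
  have hne : v (i + 2) - v (i + 1) ≠ 0 :=
    sub_ne_zero.2 (hv.injective.ne (by fin_cases i <;> decide))
  generalize h : v (i + 2) - v (i + 1) = w at hne
  rw [elen, h, norm2, Real.sqrt_ne_zero']
  have h' : w 0 ≠ 0 ∨ w 1 ≠ 0 := by
    by_contra! h'
    exact hne (funext (Fin.forall_fin_two.2 h'))
  unfold dot2
  rcases h' with h' | h'
  · nlinarith [mul_self_pos.2 h', mul_self_nonneg (w 1)]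
  · nlinarith [mul_self_pos.2 h', mul_self_nonneg (w 0)]

lemma transpose_edgeMat_mulVec_nrml (i : Fin 3) : (edgeMat v)ᵀ *ᵥ nrml v i =
    ((elen v i)⁻¹ * (edgeMat v).det) • refNormal i := by
  ext j
  fin_cases i <;> fin_cases j <;>
    simp [edgeMat, nrml, rot, tang, refNormal, Matrix.mulVec, dotProduct, Matrix.det_fin_two] <;>
    ring

lemma piola_mulVec_nrml_eq_zero_iff (hv : AffineIndependent ℝ v) (σ : V2 → Mat2) (i : Fin 3)
    (r : ℝ) : piola v σ (edgePt v i r) *ᵥ nrml v i = 0 ↔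
      σ (refEdgePt i r) *ᵥ refNormal i = 0 := by
  have hB := isUnit_det_edgeMat hv
  have h : (elen v i)⁻¹ * (edgeMat v).det ≠ 0 :=
    mul_ne_zero (inv_ne_zero (elen_ne_zero hv i)) hB.ne_zero
  rw [piola, ← affMap_refEdgePt, affInv_affMap hv, ← Matrix.mulVec_mulVec,
    transpose_edgeMat_mulVec_nrml, Matrix.mulVec_smul, smul_eq_zero_iff_right h,
    ← Matrix.mulVec_mulVec]
  refine ⟨fun h0 => ?_, fun h0 => by rw [h0, Matrix.mulVec_zero]⟩
  exact Matrix.eq_zero_of_mulVec_eq_zero hB.ne_zero h0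

lemma divMat_piola_eq (hv : AffineIndependent ℝ v) {σ : V2 → Mat2} {k : ℕ} (hσ : IsPolyMat k σ) :
    divMat (piola v σ) = fun x => edgeMat v *ᵥ divMat σ (affInv v x) :=
  funext fun x => divMat_piola (isUnit_det_edgeMat hv) (fun i j => (hσ i j).differentiable) _ x

lemma isPolyMat_piola {k : ℕ} {σ : V2 → Mat2} (hσ : IsPolyMat k σ) : IsPolyMat k (piola v σ) :=
  isPolyMat_mul_mul (τ := fun x => σ (affInv v x)) (fun i j => (hσ i j).comp isPolyVec_affInv) _ _

lemma exists_piola_eq (hv : AffineIndependent ℝ v) {τ : V2 → Mat2} {k : ℕ} (hτ : IsPolyMat k τ)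
    (hs : ∀ x, (τ x).IsSymm) :
    ∃ σ, IsPolyMat k σ ∧ (∀ y, (σ y).IsSymm) ∧ piola v σ = τ := by
  have hB := isUnit_det_edgeMat hv
  refine ⟨fun y => (edgeMat v)⁻¹ * τ (affMap v y) * ((edgeMat v)⁻¹)ᵀ,
    isPolyMat_mul_mul (τ := fun y => τ (affMap v y)) (fun i j => (hτ i j).comp isPolyVec_affMap)
      _ _, fun y => ?_, ?_⟩
  · simp only [Matrix.IsSymm, Matrix.transpose_mul, Matrix.transpose_transpose, (hs _).eq,
      Matrix.mul_assoc]
  · ext1 x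
    rw [piola, affMap_affInv hv]
    calc _ = (edgeMat v * (edgeMat v)⁻¹) * τ x * (edgeMat v * (edgeMat v)⁻¹)ᵀ := by
          rw [Matrix.transpose_mul]
          simp only [Matrix.mul_assoc]
      _ = τ x := by simp [Matrix.mul_nonsing_inv _ hB]

/-- Fields in the space `SigmaRing v` are Piola transforms of the reference bubbles. -/
lemma mem_SigmaRing_iff (hv : AffineIndependent ℝ v) {τ : V2 → Mat2} :
    τ ∈ SigmaRing v ↔ ∃ a b q, τ = piola v (bubble a b q) := by
  have hB := isUnit_det_edgeMat hv
  constructor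
  · rintro ⟨⟨h3, hs, h1, -⟩, hn⟩
    obtain ⟨σ, hσ, hσs, rfl⟩ := exists_piola_eq hv h3 hs
    have hdiv : divMat σ = fun y => (edgeMat v)⁻¹ *ᵥ divMat (piola v σ) (affMap v y) := by
      ext1 y
      simp only [divMat_piola_eq hv hσ, affInv_affMap hv, Matrix.mulVec_mulVec,
        Matrix.nonsing_inv_mul _ hB, Matrix.one_mulVec]
    obtain ⟨a, b, q, rfl⟩ := exists_eq_bubble hσ hσs
      (hdiv ▸ isPolyVec_mulVec (fun i => (h1 i).comp isPolyVec_affMap) _) fun i r hr =>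
        (piola_mulVec_nrml_eq_zero_iff hv σ i r).1
          (hn i _ (edgeSet_eq_image (v := v) i ▸ Set.mem_image_of_mem _ hr))
    exact ⟨a, b, q, rfl⟩
  · rintro ⟨a, b, q, rfl⟩
    have hn : ∀ i r, piola v (bubble a b q) (edgePt v i r) *ᵥ nrml v i = 0 := fun i r =>
      (piola_mulVec_nrml_eq_zero_iff hv _ i r).2 (bubble_mulVec_refNormal a b q i r)
    refine ⟨⟨isPolyMat_piola (isPolyMat_bubble a b q), fun x => ?_, ?_, fun i => ⟨0, by simp, ?_⟩⟩,
      fun i => ?_⟩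
    · rw [piola, Matrix.IsSymm, Matrix.transpose_mul, Matrix.transpose_mul,
        Matrix.transpose_transpose, (isSymm_bubble ..).eq, Matrix.mul_assoc]
    · rw [divMat_piola_eq hv (isPolyMat_bubble a b q)]
      exact isPolyVec_mulVec (f := fun x => divMat (bubble a b q) (affInv v x))
        (fun i => (isPolyVec_divMat_bubble a b q i).comp isPolyVec_affInv) _
    · intro r _
      simp [hn, dot2]
    · rw [edgeSet_eq_image]
      rintro _ ⟨r, -, rfl⟩
      exact hn i r

lemma affMap_image_refTri : affMap v '' refTri = tri v := by
  refine Set.Subset.antisymm ?_ (convexHull_min ?_ ?_)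
  · rintro _ ⟨y, ⟨h₀, h₁, h⟩, rfl⟩
    refine mem_convexHull_of_exists_fintype ![1 - y 0 - y 1, y 0, y 1] v ?_ ?_
      (fun i => Set.mem_range_self i) ?_
    · intro i
      fin_cases i
      · simp
        linarith
      · exact h₀
      · exact h₁
    · simp [Fin.sum_univ_three]
      ring
    · ext i
      fin_cases i <;>
        simp [affMap, edgeMat, Fin.sum_univ_three, -cons_mulVec] <;> ring
  · rintro _ ⟨i, rfl⟩
    fin_cases i
    · refine ⟨0, by simp [refTri], by simp [affMap]⟩
    · refine ⟨![1, 0], by simp [refTri], ?_⟩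
      ext i
      fin_cases i <;> simp [affMap, edgeMat]
    · refine ⟨![0, 1], by simp [refTri], ?_⟩
      ext i
      fin_cases i <;> simp [affMap, edgeMat]
  · rintro _ ⟨y, ⟨hy₀, hy₁, hy⟩, rfl⟩ _ ⟨z, ⟨hz₀, hz₁, hz⟩, rfl⟩ a b ha hb hab
    refine ⟨a • y + b • z, ⟨?_, ?_, ?_⟩, ?_⟩
    · simp only [Pi.add_apply, Pi.smul_apply, smul_eq_mul]
      positivity
    · simp only [Pi.add_apply, Pi.smul_apply, smul_eq_mul]
      positivity
    · simp only [Pi.add_apply, Pi.smul_apply, smul_eq_mul]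
      nlinarith
    · rw [affMap, affMap, affMap, Matrix.mulVec_add, Matrix.mulVec_smul, Matrix.mulVec_smul,
        smul_add, smul_add, add_add_add_comm, ← add_smul, hab, one_smul]

lemma setIntegral_tri (hv : AffineIndependent ℝ v) (f : V2 → ℝ) :
    ∫ x in tri v, f x = |(edgeMat v).det| * ∫ y in refTri, f (affMap v y) := by
  have h := integral_image_eq_integral_abs_det_fderiv_smul volume
    isCompact_refTri.measurableSet (f := affMap v)
    (f' := fun _ => (Matrix.toLin' (edgeMat v)).toContinuousLinearMap)
    (fun y _ => ((Matrix.toLin' (edgeMat v)).toContinuousLinearMap.hasFDerivAt.const_add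
      (v 0)).hasFDerivWithinAt)
    (Function.LeftInverse.injective (affInv_affMap hv)).injOn f
  rw [affMap_image_refTri] at h
  rw [h, ← integral_const_mul]
  simp [ContinuousLinearMap.det]

lemma dot2_mulVec (A : Mat2) (x y : V2) : dot2 (A *ᵥ x) y = dot2 x (Aᵀ *ᵥ y) := by
  simp [dot2, Matrix.mulVec, dotProduct]
  ring

lemma transpose_mulVec_rot_mulVec (A : Mat2) (x : V2) :
    Aᵀ *ᵥ ![(A *ᵥ x) 1, -(A *ᵥ x) 0] = A.det • ![x 1, -(x 0)] := by
  ext i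
  fin_cases i <;> simp [Matrix.mulVec, dotProduct, Matrix.det_fin_two] <;> ring

lemma transpose_mulVec_rigid (a : V2) (b : ℝ) (y : V2) :
    (edgeMat v)ᵀ *ᵥ (a + b • ![affMap v y 1, -(affMap v y 0)]) =
      (edgeMat v)ᵀ *ᵥ (a + b • ![v 0 1, -(v 0 0)]) +
        (b * (edgeMat v).det) • ![y 1, -(y 0)] := by
  rw [mul_smul, ← transpose_mulVec_rot_mulVec, ← Matrix.mulVec_smul, ← Matrix.mulVec_add]
  congr 1
  ext i
  fin_cases i
  · change a 0 + b * (v 0 1 + (edgeMat v *ᵥ y) 1) =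
      a 0 + b * v 0 1 + b * (edgeMat v *ᵥ y) 1
    ring
  · change a 1 + b * -(v 0 0 + (edgeMat v *ᵥ y) 0) =
      a 1 + b * -v 0 0 + b * -(edgeMat v *ᵥ y) 0
    ring

/-- Orthogonality to rigid motions is preserved by the Piola transform of vector fields. -/
lemma forall_setIntegral_tri_eq_zero_iff (hv : AffineIndependent ℝ v) (d : V2 → V2) :
    (∀ u ∈ RM2, ∫ x in tri v, dot2 (edgeMat v *ᵥ d (affInv v x)) (u x) = 0) ↔
      ∀ u ∈ RM2, ∫ y in refTri, dot2 (d y) (u y) = 0 := by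
  have hB := isUnit_det_edgeMat hv
  have hBT : IsUnit (edgeMat v)ᵀ.det := by rwa [Matrix.det_transpose]
  simp only [setIntegral_tri hv, affInv_affMap hv, mul_eq_zero, abs_eq_zero, hB.ne_zero,
    false_or, dot2_mulVec]
  constructor
  · rintro h u ⟨a, b, hu⟩
    have := h _ ⟨((edgeMat v)ᵀ)⁻¹ *ᵥ a - (b / (edgeMat v).det) • ![v 0 1, -(v 0 0)],
      b / (edgeMat v).det, fun _ => rfl⟩
    simp only [transpose_mulVec_rigid, sub_add_cancel, Matrix.mulVec_mulVec,
      Matrix.mul_nonsing_inv _ hBT, Matrix.one_mulVec, div_mul_cancel₀ _ hB.ne_zero] at this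
    simpa only [hu] using this
  · rintro h u ⟨a, b, hu⟩
    simp only [hu, transpose_mulVec_rigid]
    exact h _ ⟨_, _, fun _ => rfl⟩

end Triangle

/-- div Σ̊(K) = ℙ₁(K;ℝ²)/RM, and div : Σ̊(K) → ℙ₁(K;ℝ²)/RM is a
(linear) bijection. -/
theorem statement7 (v : Fin 3 → V2) (hv : AffineIndependent ℝ v) :
    (∀ τ ∈ SigmaRing v, divMat τ ∈ P1perpRM v) ∧
    (∀ p ∈ P1perpRM v, ∃! τ : V2 → Mat2, τ ∈ SigmaRing v ∧ divMat τ = p) := by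

  have hB := isUnit_det_edgeMat hv
  have hdiv : ∀ a b q, divMat (piola v (bubble a b q)) =
      fun x => edgeMat v *ᵥ divMat (bubble a b q) (affInv v x) := fun a b q =>
    divMat_piola_eq hv (isPolyMat_bubble a b q)
  constructor
  · intro τ hτ
    refine ⟨hτ.1.2.2.1, ?_⟩
    obtain ⟨a, b, q, rfl⟩ := (mem_SigmaRing_iff hv).1 hτ
    rw [hdiv, forall_setIntegral_tri_eq_zero_iff hv,
      forall_setIntegral_refTri_eq_zero_iff (isPolyVec_divMat_bubble a b q)]
    exact ⟨a, b, q, rfl⟩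
  · rintro p ⟨hp, hperp⟩
    obtain ⟨d, hd, rfl⟩ : ∃ d, IsPolyVec 1 d ∧ (fun x => edgeMat v *ᵥ d (affInv v x)) = p :=
      ⟨fun y => (edgeMat v)⁻¹ *ᵥ p (affMap v y),
        isPolyVec_mulVec (fun i => (hp i).comp isPolyVec_affMap) _, by
        simp only [affMap_affInv hv, Matrix.mulVec_mulVec, Matrix.mul_nonsing_inv _ hB,
          Matrix.one_mulVec]⟩
    rw [forall_setIntegral_tri_eq_zero_iff hv, forall_setIntegral_refTri_eq_zero_iff hd] at hperp
    obtain ⟨a, b, q, rfl⟩ := hperp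
    refine ⟨piola v (bubble a b q), ⟨(mem_SigmaRing_iff hv).2 ⟨a, b, q, rfl⟩, hdiv a b q⟩, ?_⟩
    rintro τ ⟨hτ, hτd⟩
    obtain ⟨a', b', q', rfl⟩ := (mem_SigmaRing_iff hv).1 hτ
    rw [hdiv] at hτd
    rw [bubble_eq_of_divMat_eq]
    ext1 y
    have := congrFun hτd (affMap v y)
    simp only [affInv_affMap hv] at this
    exact Matrix.mulVec_injective_of_isUnit ((Matrix.isUnit_iff_isUnit_det _).2 hB) this
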